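/- arXiv:1506.05835 — 2 statements merged into one kernel-verified Lean document; each statement's English description precedes it below -/
import Mathlib

section
/- Let T be a homeomorphism of a compact metric space X satisfying the Bronstein condition (the set of minimal points is dense in X). Then for every ε > 0 there exists a finite almost invariant ε-network, i.e., a finite set N ⊆ X such that T^n(N) is an ε-network for every n ∈ ℤ; moreover N can be chosen as a union of finite subsets of finitely many minimal sets. -/
open Metric Filter Set Topology
open scoped Classical

variable {X : Type*}

/-- A set of naturals is syndetic: bounded gaps. -/
def Syndetic (S : Set ℕ) : Prop := ∃ n : ℕ, ∀ m : ℕ, ∃ k ∈ S, m ≤ k ∧ k ≤ m + n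

/-- Forward orbit of a point. -/
def fwdOrbit (T : X → X) (y : X) : Set X := Set.range fun k : ℕ => T^[k] y

/-- A point is minimal (almost periodic): its forward orbit closure is a minimal set. -/
def IsMinimalPt [TopologicalSpace X] (T : X → X) (y : X) : Prop :=
  ∀ z ∈ closure (fwdOrbit T y), closure (fwdOrbit T z) = closure (fwdOrbit T y)

/-- ℤ-iteration of a homeomorphism. -/
noncomputable def zIter [TopologicalSpace X] (T : X ≃ₜ X) (n : ℤ) : X → X :=
  if 0 ≤ n then (⇑T)^[n.toNat] else (⇑T.symm)^[(-n).toNat]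

/-- `A` is an `ε`-network: every point of the space is within `ε` of `A`. -/
def IsNet [PseudoMetricSpace X] (ε : ℝ) (A : Set X) : Prop :=
  ∀ x : X, ∃ a ∈ A, dist x a ≤ ε

/-- A point is nonwandering (w.r.t. forward iterates). -/
def NonWandering [TopologicalSpace X] (T : X → X) (x : X) : Prop :=
  ∀ U : Set X, IsOpen U → x ∈ U → ∃ k : ℕ, 1 ≤ k ∧ ((fun p => T^[k] p) '' U ∩ U).Nonempty

/-- One-sided `d`-pseudotrajectory. -/
def IsPseudoTraj [PseudoMetricSpace X] (T : X → X) (d : ℝ) (x : ℕ → X) : Prop :=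
  ∀ k : ℕ, dist (x (k + 1)) (T (x k)) ≤ d

/-- Two-sided `d`-pseudotrajectory. -/
def IsPseudoTrajZ [PseudoMetricSpace X] (T : X → X) (d : ℝ) (x : ℤ → X) : Prop :=
  ∀ k : ℤ, dist (x (k + 1)) (T (x k)) ≤ d

/-- A chain recurrent point. -/
def ChainRec [PseudoMetricSpace X] (T : X → X) (x : X) : Prop :=
  ∀ d > (0 : ℝ), ∃ n : ℕ, 1 ≤ n ∧ ∃ c : ℕ → X, c 0 = x ∧ c n = x ∧
    ∀ k < n, dist (c (k + 1)) (T (c k)) ≤ d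

/-- ω-limit set of a point under a map. -/
def omegaSet [TopologicalSpace X] (T : X → X) (y : X) : Set X :=
  {p | ∃ φ : ℕ → ℕ, StrictMono φ ∧ Tendsto (fun n => T^[φ n] y) atTop (nhds p)}

/-- The set of recurrent points (`x ∈ ω(x)`). -/
def RecurrentPts [TopologicalSpace X] (T : X → X) : Set X := {x | x ∈ omegaSet T x}

/-- The multishadowing property (for homeomorphisms, two-sided). -/
def Multishadowing [PseudoMetricSpace X] (T : X ≃ₜ X) : Prop :=
  ∀ ε > (0 : ℝ), ∃ d > (0 : ℝ), ∀ x : ℤ → X, IsPseudoTrajZ (⇑T) d x →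
    ∃ Y : Finset X, ∀ k : ℤ, ∃ y ∈ Y, dist (x k) (zIter T k y) < ε

/-- Topological support of a measure: points all of whose open neighborhoods
have positive measure. -/
def msupp [TopologicalSpace X] [MeasurableSpace X] (μ : MeasureTheory.Measure X) : Set X :=
  {x | ∀ U : Set X, IsOpen U → x ∈ U → 0 < μ U}

/-- Counting function for density computations. -/
noncomputable def cnt (K : Set ℕ) (N : ℕ) : ℝ :=
  ((Finset.range (N + 1)).filter (· ∈ K)).card


lemma aux_symm [TopologicalSpace X] (T : X ≃ₜ X) (y : X) (hy : IsMinimalPt (⇑T) y) :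
    ∀ z, z ∈ closure (fwdOrbit T y) ↔ T z ∈ closure (fwdOrbit T y) := by
  have h1 : T y ∈ closure (fwdOrbit T y) := subset_closure ⟨1, rfl⟩
  have h2 := hy _ h1
  have h3 : fwdOrbit T (T y) = T '' fwdOrbit T y := by
    unfold fwdOrbit
    rw [← Set.range_comp]
    congr 1
    funext k
    simp only [Function.comp]
    rw [← Function.iterate_succ_apply, Function.iterate_succ_apply']
  rw [h3, ← T.image_closure] at h2
  intro z
  conv_rhs => rw [← h2]
  exact (T.injective.mem_set_image).symm

lemma aux_zIter [TopologicalSpace X] (T : X ≃ₜ X) (y : X) (hy : IsMinimalPt (⇑T) y) (n : ℤ) :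
    zIter T n y ∈ closure (fwdOrbit T y) := by
  unfold zIter
  split_ifs with h
  · exact subset_closure ⟨_, rfl⟩
  · generalize (-n).toNat = m
    induction m with
    | zero => exact subset_closure ⟨0, rfl⟩
    | succ m ih =>
      rw [Function.iterate_succ_apply', aux_symm T y hy]
      simpa using ih

lemma aux_comm [TopologicalSpace X] (T : X ≃ₜ X) (n : ℤ) (k : ℕ) (y : X) :
    zIter T n ((⇑T)^[k] y) = (⇑T)^[k] (zIter T n y) := by
  unfold zIter
  split_ifs with h
  · rw [← Function.iterate_add_apply, ← Function.iterate_add_apply, add_comm]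
  · have : Function.Commute (⇑T.symm) (⇑T) := fun x => by simp
    exact (this.iterate_iterate _ _) y

lemma aux_K [MetricSpace X] [CompactSpace X] (T : X ≃ₜ X) (y : X) (hy : IsMinimalPt (⇑T) y)
    (ε : ℝ) (hε : 0 < ε) :
    ∃ t : Finset ℕ, ∀ z ∈ closure (fwdOrbit T y), ∃ k ∈ t, dist y ((⇑T)^[k] z) < ε := by
  obtain ⟨t, ht⟩ := (isClosed_closure (s := fwdOrbit T y)).isCompact.elim_finite_subcover
    (fun k : ℕ => {z | dist y ((⇑T)^[k] z) < ε})
    (fun k => isOpen_lt (continuous_const.dist (T.continuous.iterate k)) continuous_const)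
    (by
      intro z hz
      have : y ∈ closure (fwdOrbit T z) := by
        rw [hy z hz]; exact subset_closure ⟨0, rfl⟩
      obtain ⟨_, ⟨k, rfl⟩, hk⟩ := Metric.mem_closure_iff.1 this ε hε
      exact mem_iUnion.2 ⟨k, hk⟩)
  refine ⟨t, fun z hz => ?_⟩
  obtain ⟨k, hk, h⟩ := mem_iUnion₂.1 (ht hz)
  exact ⟨k, hk, h⟩

theorem stmt5 [MetricSpace X] [CompactSpace X] (T : X ≃ₜ X)
    (hBr : Dense {y : X | IsMinimalPt (⇑T) y}) :
    ∀ ε > (0 : ℝ), ∃ N : Finset X, (∀ a ∈ N, IsMinimalPt (⇑T) a) ∧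
      ∀ n : ℤ, IsNet ε (zIter T n '' (N : Set X)) := by
  intro ε hε
  have hε2 : 0 < ε / 2 := by linarith
  obtain ⟨s, hs⟩ := (isCompact_univ (X := X)).elim_finite_subcover
    (fun y : {y : X | IsMinimalPt (⇑T) y} => ball (y : X) (ε / 2)) (fun _ => isOpen_ball)
    (by
      intro x _
      obtain ⟨y, hy, hxy⟩ := hBr.exists_dist_lt x hε2
      exact mem_iUnion.2 ⟨⟨y, hy⟩, hxy⟩)
  choose t ht using fun y : {y : X | IsMinimalPt (⇑T) y} => aux_K T y y.2 (ε / 2) hε2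
  refine ⟨s.biUnion fun y => (t y).image fun k => (⇑T)^[k] (y : X), ?_, ?_⟩
  · intro a ha
    simp only [Finset.mem_biUnion, Finset.mem_image] at ha
    obtain ⟨y, -, k, -, rfl⟩ := ha
    have h := y.2 ((⇑T)^[k] (y : X)) (subset_closure ⟨k, rfl⟩)
    intro z hz
    rw [h] at hz ⊢
    exact y.2 z hz
  · intro n x
    obtain ⟨y, hy, hxy⟩ := mem_iUnion₂.1 (hs (mem_univ x))
    obtain ⟨k, hk, hd⟩ := ht y _ (aux_zIter T y y.2 n)
    refine ⟨zIter T n ((⇑T)^[k] (y : X)), mem_image_of_mem _ ?_, ?_⟩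
    · rw [Finset.mem_coe, Finset.mem_biUnion]
      exact ⟨y, hy, Finset.mem_image.2 ⟨k, hk, rfl⟩⟩
    · rw [aux_comm]
      have := dist_triangle x (y : X) ((⇑T)^[k] (zIter T n y))
      have h' : dist x (y : X) < ε / 2 := hxy
      linarith
end

section
/- Let T be a homeomorphism of a compact metric space X such that the closure of the set of minimal points equals the nonwandering set and Ω(X,T) = X. Then for any countable family Φ = {φ_i} of continuous real-valued functions on X there exists a T-invariant set Ξ, dense in X, such that for every φ ∈ Φ and every x ∈ Ξ the Birkhoff average lim_{n→∞} (1/n) Σ_{k=0}^{n-1} φ(T^k(x)) exists. -/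
open Metric Filter Set Topology
open scoped Classical

variable {X : Type*}

theorem bk_L1 {T : X → X} {M : Set X} (hM : MapsTo T M M) (g : X → ℝ) (C : ℝ)
    (hC : ∀ x ∈ M, |g x| ≤ C) (N n : ℕ) (x : X) (hx : x ∈ M)
    (h : N * C < birkhoffSum T g n x) :
    ∃ y ∈ M, ∀ m ≤ N, 0 ≤ birkhoffSum T g m y := by
  have hit : ∀ k, T^[k] x ∈ M := fun k => hM.iterate k hx
  have hC0 : 0 ≤ C := (abs_nonneg _).trans (hC x hx)
  obtain ⟨k, hk, hmin⟩ := Finset.exists_min_image (Finset.range (n+1))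
    (fun k => birkhoffSum T g k x) ⟨0, by simp⟩
  have hk' : k ≤ n := by simpa [Nat.lt_succ_iff] using hk
  have h0 : birkhoffSum T g k x ≤ 0 := by
    simpa using hmin 0 (by simp)
  have hkN : k + N ≤ n := by
    by_contra hcon
    obtain ⟨d, rfl⟩ := Nat.exists_eq_add_of_le hk'
    rw [birkhoffSum_add] at h
    have : birkhoffSum T g d (T^[k] x) ≤ d * C := by
      unfold birkhoffSum
      calc _ ≤ ∑ _i ∈ Finset.range d, C := by
            refine Finset.sum_le_sum fun i _ => ?_
            exact (le_abs_self _).trans (hC _ (hM.iterate i (hit k)))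
        _ = _ := by simp
    have hd : (d : ℝ) ≤ N := by exact_mod_cast (by omega : d ≤ N)
    nlinarith
  refine ⟨T^[k] x, hit k, fun m hm => ?_⟩
  have := hmin (k + m) (by simp; omega)
  simp only [birkhoffSum_add] at this
  linarith

theorem bk_cont [TopologicalSpace X] {E : Type*} [NormedAddCommGroup E] {T : X → X}
    (hT : Continuous T) {g : X → E} (hg : Continuous g) (n : ℕ) :
    Continuous (birkhoffSum T g n) := by
  unfold birkhoffSum
  exact continuous_finsetSum _ fun i _ => hg.comp (hT.iterate i)

theorem bk_L2 [TopologicalSpace X] [T2Space X] {T : X → X} (hT : Continuous T) {M : Set X}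
    (hM : MapsTo T M M)
    (hMc : IsCompact M) (g : X → ℝ) (hg : Continuous g) (α : ℝ)
    (h : ∀ ε > (0:ℝ), ∀ N : ℕ, ∃ n ≥ N, ∃ x ∈ M, n * (α - ε) ≤ birkhoffSum T g n x) :
    ∃ x ∈ M, ∀ n : ℕ, n * α ≤ birkhoffSum T g n x := by
  have hsub : ∀ (c : ℝ) (n : ℕ) (x : X),
      birkhoffSum T (fun z => g z - c) n x = birkhoffSum T g n x - n * c := by
    intro c n x
    simp [birkhoffSum, Finset.sum_sub_distrib]
  let t : ℕ → Set X := fun j => M ∩ {x | ∀ m : ℕ, m ≤ j → m * (α - 1/((j:ℝ)+1)) ≤ birkhoffSum T g m x}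
  have hcl : ∀ j, IsClosed {x | ∀ m : ℕ, m ≤ j → m * (α - 1/((j:ℝ)+1)) ≤ birkhoffSum T g m x} := by
    intro j
    simp only [Set.ofPred_forall]
    exact isClosed_iInter fun m => isClosed_iInter fun _ =>
      isClosed_le continuous_const (bk_cont hT hg m)
  have hne : (⋂ j, t j).Nonempty := by
    apply IsCompact.nonempty_iInter_of_sequence_nonempty_isCompact_isClosed
    · rintro j x ⟨hx, hx'⟩
      refine ⟨hx, fun m hm => le_trans ?_ (hx' m (by omega))⟩
      push_cast
      gcongr
      linarith
    · intro j
      set ε : ℝ := 1/((j:ℝ)+1) with hε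
      have hε0 : 0 < ε := by positivity
      obtain ⟨C, hC⟩ := hMc.exists_bound_of_continuousOn
        (f := fun z => g z - (α - ε)) (by fun_prop)
      obtain ⟨N, hN⟩ := exists_nat_gt (j * C / (ε / 2))
      obtain ⟨n, hn, x, hx, hxx⟩ := h (ε/2) (by positivity) N
      obtain ⟨y, hy, hyy⟩ := bk_L1 hM (fun z => g z - (α - ε)) C hC j n x hx (by
        rw [hsub]
        rw [div_lt_iff₀ (by positivity)] at hN
        have : (N:ℝ) ≤ n := by exact_mod_cast hn
        nlinarith)
      refine ⟨y, hy, fun m hm => ?_⟩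
      have := hyy m hm
      rw [hsub] at this
      linarith
    · exact hMc.inter_right (hcl 0)
    · exact fun j => hMc.isClosed.inter (hcl j)
  obtain ⟨x, hx⟩ := hne
  rw [mem_iInter] at hx
  refine ⟨x, (hx 0).1, fun n => ?_⟩
  have h1 : Tendsto (fun j : ℕ => (n:ℝ) * (α - 1/((j:ℝ)+1))) atTop (𝓝 (n * (α - 0))) :=
    (tendsto_const_nhds.sub tendsto_one_div_add_atTop_nhds_zero_nat).const_mul _
  rw [sub_zero] at h1
  refine le_of_tendsto h1 ?_
  filter_upwards [eventually_ge_atTop n] with j hj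
  exact (hx j).2 n hj

theorem bk_main [TopologicalSpace X] [T2Space X] {H : Type*} [NormedAddCommGroup H]
    [InnerProductSpace ℝ H] [CompleteSpace H] {T : X → X} (hT : Continuous T) {M : Set X}
    (hM : MapsTo T M M) (hMc : IsCompact M) (hMn : M.Nonempty) (F : X → H) (hF : Continuous F) :
    ∃ x ∈ M, ∃ v : H, Tendsto (fun n => birkhoffAverage ℝ T F n x) atTop (𝓝 v) := by
  let Cc : Set H := closure (convexHull ℝ (F '' M))
  have hCc : IsCompact Cc := by
    have h1 : TotallyBounded (convexHull ℝ (F '' M)) :=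
      totallyBounded_convexHull.2 (hMc.image hF).totallyBounded
    exact isCompact_iff_totallyBounded_isComplete.2 ⟨h1.closure, isClosed_closure.isComplete⟩
  have hav : ∀ n : ℕ, 0 < n → ∀ x ∈ M, birkhoffAverage ℝ T F n x ∈ convexHull ℝ (F '' M) := by
    intro n hn x hx
    have hn' : (n:ℝ) ≠ 0 := by positivity
    rw [birkhoffAverage, birkhoffSum, Finset.smul_sum]
    refine (convex_convexHull ℝ _).sum_mem (fun i _ => by positivity) (by simp [hn']) ?_
    intro i _
    exact subset_convexHull ℝ _ ⟨_, hM.iterate i hx, rfl⟩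
  let A : ℕ → Set H := fun N => {w | ∃ n > N, ∃ x ∈ M, birkhoffAverage ℝ T F n x = w}
  let K : ℕ → Set H := fun N => closure (A N)
  have hAmono : Antitone A := by
    rintro a b hab w ⟨n, hn, x, hx, rfl⟩
    exact ⟨n, lt_of_le_of_lt hab hn, x, hx, rfl⟩
  have hKmono : Antitone K := fun a b hab => closure_mono (hAmono hab)
  have hKc : ∀ N, IsCompact (K N) := by
    intro N
    refine hCc.of_isClosed_subset isClosed_closure (closure_mono ?_)
    rintro w ⟨n, hn, x, hx, rfl⟩
    exact hav n (by omega) x hx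
  obtain ⟨x₀, hx₀⟩ := hMn
  have hKn : (⋂ N, K N).Nonempty := by
    refine IsCompact.nonempty_iInter_of_sequence_nonempty_isCompact_isClosed K
      (fun i => hKmono (Nat.le_succ i)) (fun i => ?_) (hKc 0) (fun i => isClosed_closure)
    exact ⟨_, subset_closure ⟨i+1, Nat.lt_succ_self i, x₀, hx₀, rfl⟩⟩
  have hKic : IsCompact (⋂ N, K N) :=
    (hKc 0).of_isClosed_subset (isClosed_iInter fun _ => isClosed_closure) (iInter_subset _ 0)
  obtain ⟨v, hv, hvmax⟩ := hKic.exists_isMaxOn hKn continuous_norm.continuousOn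
  have hb : ∀ ε > (0:ℝ), ∃ N, ∀ n > N, ∀ x ∈ M, ‖birkhoffAverage ℝ T F n x‖ < ‖v‖ + ε := by
    intro ε hε
    obtain ⟨N, hN⟩ := exists_subset_nhds_of_isCompact (V := K) (U := ball 0 (‖v‖ + ε))
      (directed_of_isDirected_le hKmono) hKc (by
        intro w hw
        refine isOpen_ball.mem_nhds ?_
        have : ‖w‖ ≤ ‖v‖ := hvmax hw
        rw [mem_ball_zero_iff]
        linarith)
    refine ⟨N, fun n hn x hx => ?_⟩
    exact mem_ball_zero_iff.1 (hN (subset_closure ⟨n, hn, x, hx, rfl⟩))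
  have hsum : ∀ (n : ℕ) (x : X), birkhoffSum T (fun z => inner ℝ v (F z)) n x
      = n * inner ℝ v (birkhoffAverage ℝ T F n x) := by
    intro n x
    rcases Nat.eq_zero_or_pos n with rfl | hn
    · simp
    have hn' : (n:ℝ) ≠ 0 := by positivity
    rw [birkhoffAverage, inner_smul_right, birkhoffSum, birkhoffSum, inner_sum]
    field_simp
  obtain ⟨x, hx, hxx⟩ := bk_L2 hT hM hMc (fun z => inner ℝ v (F z)) (by fun_prop) (‖v‖^2) (by
    intro ε hε N
    have hvN : v ∈ closure (A N) := mem_iInter.1 hv N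
    obtain ⟨δ, hδ, hδε⟩ : ∃ δ > (0:ℝ), ‖v‖ * δ ≤ ε :=
      ⟨ε / (‖v‖ + 1), by positivity, by
        rw [mul_div_assoc', div_le_iff₀ (by positivity)]; nlinarith [norm_nonneg v]⟩
    obtain ⟨w, ⟨n, hn, x, hx, rfl⟩, hw⟩ := Metric.mem_closure_iff.1 hvN δ hδ
    refine ⟨n, by omega, x, hx, ?_⟩
    rw [hsum]
    gcongr
    have h1 := real_inner_le_norm v (v - birkhoffAverage ℝ T F n x)
    rw [inner_sub_right, real_inner_self_eq_norm_sq, ← dist_eq_norm] at h1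
    have := mul_le_mul_of_nonneg_left hw.le (norm_nonneg v)
    linarith)
  refine ⟨x, hx, v, ?_⟩
  have hsq : ∀ n : ℕ, 0 < n → ‖birkhoffAverage ℝ T F n x - v‖^2
      ≤ ‖birkhoffAverage ℝ T F n x‖^2 - ‖v‖^2 := by
    intro n hn
    have h1 := hxx n
    rw [hsum] at h1
    have h2 := le_of_mul_le_mul_left h1 (by positivity)
    rw [norm_sub_sq_real, real_inner_comm]
    linarith
  rw [Metric.tendsto_atTop]
  intro ε hε
  obtain ⟨δ, hδ, hδε⟩ : ∃ δ > (0:ℝ), (‖v‖ + δ)^2 - ‖v‖^2 < ε^2 := by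
    have hc : Tendsto (fun δ : ℝ => (‖v‖ + δ)^2 - ‖v‖^2) (𝓝[>] 0) (𝓝 ((‖v‖ + 0)^2 - ‖v‖^2)) :=
      ((by fun_prop : Continuous fun δ : ℝ => (‖v‖ + δ)^2 - ‖v‖^2).tendsto 0).mono_left
        nhdsWithin_le_nhds
    have := (hc.eventually_lt_const (u := ε^2) (by simp; positivity)).and self_mem_nhdsWithin
    obtain ⟨δ, h1, h2⟩ := this.exists
    exact ⟨δ, h2, h1⟩
  obtain ⟨N, hN⟩ := hb δ hδ
  refine ⟨N+1, fun n hn => ?_⟩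
  have h1 := hN n (by omega) x hx
  have h2 := hsq n (by omega)
  rw [dist_eq_norm]
  refine lt_of_pow_lt_pow_left₀ 2 hε.le ?_
  have h3 : ‖birkhoffAverage ℝ T F n x‖^2 ≤ (‖v‖ + δ)^2 := by gcongr
  linarith

theorem bk_family [TopologicalSpace X] [CompactSpace X] [T2Space X] {T : X → X}
    (hT : Continuous T) {M : Set X}
    (hM : MapsTo T M M) (hMc : IsCompact M) (hMn : M.Nonempty)
    (φ : ℕ → X → ℝ) (hφ : ∀ i, Continuous (φ i)) :
    ∃ x ∈ M, ∀ i, ∃ L : ℝ, Tendsto (fun n => birkhoffAverage ℝ T (φ i) n x) atTop (𝓝 L) := by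
  have hbd : ∀ i, ∃ C : ℝ, 0 ≤ C ∧ ∀ x, |φ i x| ≤ C := by
    intro i
    obtain ⟨C, hC⟩ := isCompact_univ.exists_bound_of_continuousOn (hφ i).continuousOn
    exact ⟨max C 0, le_max_right _ _, fun x => (hC x (mem_univ x)).trans (le_max_left _ _)⟩
  choose C hC0 hC using hbd
  let c : ℕ → ℝ := fun i => (1/2)^i / (C i + 1)
  have hc : ∀ i, 0 < c i := fun i => by have := hC0 i; positivity
  let f : ℕ → X → lp (fun _ : ℕ => ℝ) 2 := fun i x => lp.single 2 i (c i * φ i x)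
  have hf : ∀ i, Continuous (f i) := by
    intro i
    have : f i = fun x => (c i * φ i x) • lp.single (E := fun _ : ℕ => ℝ) 2 i (1:ℝ) := by
      funext x
      rw [← lp.single_smul]
      simp [f]
    rw [this]
    have := hφ i
    fun_prop
  have hfb : ∀ i x, ‖f i x‖ ≤ (1/2:ℝ)^i := by
    intro i x
    have h0 := hC0 i
    rw [lp.norm_single (by norm_num), norm_mul, Real.norm_eq_abs, Real.norm_eq_abs,
      abs_of_pos (hc i)]
    calc c i * |φ i x| ≤ c i * (C i + 1) := by
          have := hC i x
          have := hc i
          gcongr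
          linarith
      _ = _ := by simp only [c]; field_simp
  have hsum : Summable fun i : ℕ => (1/2:ℝ)^i := summable_geometric_two
  have hF := continuous_tsum hf hsum hfb
  obtain ⟨x, hx, v, hv⟩ := bk_main hT hM hMc hMn _ hF
  refine ⟨x, hx, fun i => ⟨(c i)⁻¹ * v i, ?_⟩⟩
  let e : lp (fun _ : ℕ => ℝ) 2 →L[ℝ] ℝ := lp.evalCLM ℝ (fun _ : ℕ => ℝ) 2 i
  have he : ∀ z, e (∑' n, f n z) = c i * φ i z := by
    intro z
    have hs : Summable fun n => f n z := Summable.of_norm_bounded hsum fun n => hfb n z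
    rw [e.map_tsum hs, tsum_eq_single i]
    · exact lp.single_apply_self (E := fun _ : ℕ => ℝ) 2 i (c i * φ i z)
    · intro j hj
      exact lp.single_apply_ne (E := fun _ : ℕ => ℝ) 2 j (c j * φ j z) hj.symm
  have h1 := ((e.continuous.tendsto v).comp hv).const_mul (c i)⁻¹
  refine h1.congr fun n => ?_
  simp only [Function.comp]
  rw [map_birkhoffAverage ℝ ℝ e]
  have hci := (hc i).ne'
  simp only [birkhoffAverage, birkhoffSum, Function.comp, he, ← Finset.mul_sum, smul_eq_mul]
  field_simp

theorem stmt17 [MetricSpace X] [CompactSpace X] (T : X ≃ₜ X)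
    (hΩ : ∀ x : X, NonWandering (⇑T) x)
    (hBr : closure {y : X | IsMinimalPt (⇑T) y} = {x : X | NonWandering (⇑T) x})
    (φ : ℕ → X → ℝ) (hφ : ∀ i, Continuous (φ i)) :
    ∃ Ξ : Set X, ⇑T '' Ξ = Ξ ∧ Dense Ξ ∧
      ∀ (i : ℕ), ∀ x ∈ Ξ, ∃ L : ℝ,
        Tendsto (fun n : ℕ => (1 / (n : ℝ)) * ∑ k ∈ Finset.range n, φ i (T^[k] x))
          atTop (nhds L) := by
  have hconv : ∀ i (n : ℕ) x, (1 / (n : ℝ)) * ∑ k ∈ Finset.range n, φ i (T^[k] x)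
      = birkhoffAverage ℝ T (φ i) n x := by
    intro i n x
    simp [birkhoffAverage, birkhoffSum]
  simp only [hconv]
  have hdiff : ∀ i x, Tendsto (fun n => birkhoffAverage ℝ T (φ i) n (T x) -
      birkhoffAverage ℝ T (φ i) n x) atTop (𝓝 0) := fun i x =>
    tendsto_birkhoffAverage_apply_sub_birkhoffAverage' ℝ (isCompact_range (hφ i)).isBounded T x
  have hfw : ∀ i x, (∃ L : ℝ, Tendsto (fun n => birkhoffAverage ℝ T (φ i) n x) atTop (𝓝 L)) ↔
      ∃ L : ℝ, Tendsto (fun n => birkhoffAverage ℝ T (φ i) n (T x)) atTop (𝓝 L) := by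
    intro i x
    constructor
    · rintro ⟨L, hL⟩
      exact ⟨L, by simpa using hL.add (hdiff i x)⟩
    · rintro ⟨L, hL⟩
      exact ⟨L, by simpa using hL.sub (hdiff i x)⟩
  let Ξ : Set X := {x | ∀ i, ∃ L : ℝ,
    Tendsto (fun n => birkhoffAverage ℝ T (φ i) n x) atTop (𝓝 L)}
  have hΞ : ∀ x, x ∈ Ξ ↔ T x ∈ Ξ := fun x => forall_congr' fun i => hfw i x
  have hΞk : ∀ (k : ℕ) x, x ∈ Ξ → T^[k] x ∈ Ξ := by
    intro k
    induction k with
    | zero => intro x hx; exact hx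
    | succ k ih => intro x hx; exact ih _ ((hΞ x).1 hx)
  refine ⟨Ξ, ?_, ?_, fun i x hx => hx i⟩
  · ext x
    constructor
    · rintro ⟨y, hy, rfl⟩
      exact (hΞ y).1 hy
    · intro hx
      exact ⟨T.symm x, (hΞ _).2 (by simpa using hx), by simp⟩
  · have hmin : Dense {y : X | IsMinimalPt (⇑T) y} := by
      intro x
      rw [hBr]
      exact hΩ x
    rw [dense_iff_inter_open]
    intro U hU hUn
    obtain ⟨y, hyU, hy⟩ := hmin.inter_open_nonempty U hU hUn
    have hymem : y ∈ closure (fwdOrbit T y) := subset_closure ⟨0, rfl⟩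
    obtain ⟨x, hx, hxx⟩ := bk_family T.continuous (M := closure (fwdOrbit T y))
      (by
        refine MapsTo.closure ?_ T.continuous
        rintro _ ⟨k, rfl⟩
        exact ⟨k+1, Function.iterate_succ_apply' _ _ _⟩)
      isClosed_closure.isCompact ⟨y, hymem⟩ φ hφ
    have hyx : y ∈ closure (fwdOrbit T x) := by rw [hy x hx]; exact hymem
    obtain ⟨_, hzU, ⟨k, rfl⟩⟩ := mem_closure_iff.1 hyx U hU hyU
    exact ⟨_, hzU, hΞk k x hxx⟩
end
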